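/- arXiv:2404.05153 — 2 statements merged into one kernel-verified Lean document; each statement's English description precedes it below -/
import Mathlib

section
/- Let E be the metric tripod obtained by gluing three segments of lengths π/2, π/2 and π/4 at a common endpoint, with the induced path metric. Then E is a compact, simply connected geodesic space and d_GH(E, S¹) = π/4. -/
open Real Set Metric
open scoped ENNReal unitInterval

noncomputable section

/-- A *length space*: the distance between any two points equals the infimum of the
lengths (total variations) of continuous paths joining them. -/
def IsLengthSpace (X : Type*) [MetricSpace X] : Prop :=
  ∀ x y : X,
    ENNReal.ofReal (dist x y) =
      ⨅ γ ∈ {γ : ℝ → X | ContinuousOn γ (Set.Icc 0 1) ∧ γ 0 = x ∧ γ 1 = y},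
        eVariationOn γ (Set.Icc 0 1)

/-- A *geodesic space*: any two points are joined by a path whose length equals
their distance. -/
def IsGeodesicSpace (X : Type*) [MetricSpace X] : Prop :=
  ∀ x y : X, ∃ γ : ℝ → X, ContinuousOn γ (Set.Icc 0 1) ∧ γ 0 = x ∧ γ 1 = y ∧
    eVariationOn γ (Set.Icc 0 1) = ENNReal.ofReal (dist x y)

/-- A continuous map `γ : [0,1] → Y` is a loop if its endpoints agree. -/
def IsLoop {Y : Type*} [TopologicalSpace Y] (γ : C(unitInterval, Y)) : Prop := γ 0 = γ 1

/-- Two loops are homotopic *through loops* (free homotopy of loops). -/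
def LoopHomotopic {Y : Type*} [TopologicalSpace Y] (γ γ' : C(unitInterval, Y)) : Prop :=
  ∃ H : C(unitInterval × unitInterval, Y),
    (∀ t, H (0, t) = γ t) ∧ (∀ t, H (1, t) = γ' t) ∧ ∀ s, H (s, 0) = H (s, 1)

/-- A loop is nulhomotopic if it is homotopic, through loops, to a constant loop. -/
def IsNullLoop {Y : Type*} [TopologicalSpace Y] (γ : C(unitInterval, Y)) : Prop :=
  ∃ y : Y, LoopHomotopic γ (ContinuousMap.const _ y)

/-- A correspondence between `X` and `Y`: a relation whose two projections are surjective. -/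
def IsCorrespondence {X Y : Type*} (R : Set (X × Y)) : Prop :=
  (∀ x : X, ∃ y : Y, (x, y) ∈ R) ∧ (∀ y : Y, ∃ x : X, (x, y) ∈ R)

/-- The distortion of a relation `R ⊆ X × Y`,
`dis R = sup {|d_X(x,x') − d_Y(y,y')| : (x,y), (x',y') ∈ R}` (in `ℝ≥0∞`). -/
noncomputable def distortion {X Y : Type*} [MetricSpace X] [MetricSpace Y]
    (R : Set (X × Y)) : ℝ≥0∞ :=
  ⨆ (p : R) (q : R),
    ENNReal.ofReal |dist (p : X × Y).1 (q : X × Y).1 - dist (p : X × Y).2 (q : X × Y).2|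

/-- The Gromov–Hausdorff distance, expressed as half the infimal distortion of
correspondences between `X` and `Y` (valued in `ℝ≥0∞`). -/
noncomputable def ghDist (X Y : Type*) [MetricSpace X] [MetricSpace Y] : ℝ≥0∞ :=
  (⨅ R : {R : Set (X × Y) // IsCorrespondence R}, distortion (R : Set (X × Y))) / 2

/-- The circle of circumference `2π`, i.e. `ℝ/2πℤ`, with its intrinsic (quotient) metric. -/
abbrev IntrinsicCircle := AddCircle (2 * π)

instance : Fact ((0:ℝ) < 2 * π) := ⟨by positivity⟩

/-- The lengths `π/2, π/2, π/4` of the three legs of the tripod `E`. -/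
def tripodLeg : Fin 3 → ℝ := ![π/2, π/2, π/4]

/-- The tripod `E`: three segments of lengths `π/2`, `π/2`, `π/4` glued at a common
endpoint (the origin), realized as a union of coordinate segments in `ℝ³` with the
`ℓ¹`-metric; the induced metric is exactly the path metric of the tripod. -/
def TripodSet : Set (PiLp 1 fun _ : Fin 3 => ℝ) :=
  {p | ∃ (i : Fin 3) (t : ℝ), 0 ≤ t ∧ t ≤ tripodLeg i ∧
    p = (WithLp.equiv 1 (∀ _ : Fin 3, ℝ)).symm (fun j => if j = i then t else 0)}

/-- The tripod `E` as a metric space. -/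
abbrev TripodE : Type := ↥TripodSet

/-- An arc from `x` to `y`: a subspace homeomorphic to `[0,1]`, with endpoints `x` and `y`. -/
def IsArcBetween {X : Type*} [TopologicalSpace X] (x y : X) (A : Set X) : Prop :=
  ∃ γ : C(unitInterval, X), Function.Injective γ ∧ γ 0 = x ∧ γ 1 = y ∧ Set.range γ = A

/-- An `ℝ`-tree: every pair of distinct points is joined by a unique arc, and this arc
is a geodesic segment (isometric to a real interval). -/
def IsRTree (X : Type*) [MetricSpace X] : Prop :=
  ∀ x y : X, x ≠ y →
    (∃! A : Set X, IsArcBetween x y A) ∧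
    ∀ A : Set X, IsArcBetween x y A →
      ∃ γ : ℝ → X, γ 0 = x ∧ γ (dist x y) = y ∧
        γ '' Set.Icc 0 (dist x y) = A ∧
        ∀ s ∈ Set.Icc 0 (dist x y), ∀ t ∈ Set.Icc 0 (dist x y), dist (γ s) (γ t) = |s - t|

/-- The length of an `ℝ`-tree: the supremum of sums of lengths of pairwise disjoint arcs
contained in it.  (In an `ℝ`-tree every arc is a geodesic segment, so its length is its
diameter.) -/
noncomputable def treeLength (X : Type*) [MetricSpace X] : ℝ≥0∞ :=
  ⨆ (S : Finset (Set X)) (_ : (∀ A ∈ S, ∃ x y : X, x ≠ y ∧ IsArcBetween x y A) ∧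
      (S : Set (Set X)).Pairwise Disjoint), ∑ A ∈ S, EMetric.diam A

/-- The point at distance `t` from the centre on the `i`-th coordinate axis. -/
def axisPoint (i : Fin 3) (t : ℝ) : PiLp 1 fun _ : Fin 3 => ℝ :=
  (WithLp.equiv 1 (∀ _ : Fin 3, ℝ)).symm (fun j => if j = i then t else 0)

theorem axisPoint_mem {i : Fin 3} {t : ℝ} (h0 : 0 ≤ t) (h1 : t ≤ tripodLeg i) :
    axisPoint i t ∈ TripodSet :=
  ⟨i, t, h0, h1, rfl⟩

theorem dist_axisPoint (i j : Fin 3) (s t : ℝ) :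
    dist (axisPoint i s) (axisPoint j t) = if i = j then |s - t| else |s| + |t| := by
  rw [PiLp.dist_eq_of_L1]
  fin_cases i <;> fin_cases j <;>
    simp [axisPoint, Fin.sum_univ_three, Real.dist_eq, add_comm]

theorem continuous_axisPoint (i : Fin 3) : Continuous (axisPoint i) := by
  refine (PiLp.continuous_toLp 1 _).comp (continuous_pi fun j => ?_)
  split_ifs <;> fun_prop

theorem tripodLeg_le (i : Fin 3) : tripodLeg i ≤ π / 2 := by
  have := pi_pos
  fin_cases i <;> simp [tripodLeg]
  linarith

theorem tripodLeg_nonneg (i : Fin 3) : 0 ≤ tripodLeg i := by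
  have := pi_pos
  fin_cases i <;> simp [tripodLeg] <;> positivity

theorem isCompact_tripodSet : IsCompact TripodSet := by
  have h : TripodSet = ⋃ i : Fin 3, axisPoint i '' Set.Icc 0 (tripodLeg i) := by
    ext p
    simp only [TripodSet, Set.mem_ofPred_eq, Set.mem_iUnion, Set.mem_image, Set.mem_Icc]
    constructor
    · rintro ⟨i, t, h0, h1, rfl⟩
      exact ⟨i, t, ⟨h0, h1⟩, rfl⟩
    · rintro ⟨i, t, ⟨h0, h1⟩, rfl⟩
      exact ⟨i, t, h0, h1, rfl⟩
  rw [h]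
  exact isCompact_iUnion fun i => isCompact_Icc.image (continuous_axisPoint i)

theorem starConvex_tripodSet : StarConvex ℝ 0 TripodSet := by
  rw [starConvex_zero_iff]
  rintro p ⟨i, t, h0, h1, rfl⟩ a ha0 ha1
  refine ⟨i, a * t, mul_nonneg ha0 h0, (mul_le_of_le_one_left h0 ha1).trans h1, ?_⟩
  ext j
  by_cases h : j = i <;> simp [h]

theorem zero_mem_tripodSet : (0 : PiLp 1 fun _ : Fin 3 => ℝ) ∈ TripodSet := by
  refine ⟨0, 0, le_rfl, tripodLeg_nonneg 0, ?_⟩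
  ext j
  simp

theorem simplyConnectedSpace_tripodE : SimplyConnectedSpace TripodE := by
  have : ContractibleSpace TripodE :=
    starConvex_tripodSet.contractibleSpace ⟨0, zero_mem_tripodSet⟩
  infer_instance

/-- The variation over `[0, 1]` of a path of constant speed is the distance between
its endpoints. -/
theorem eVariationOn_eq_of_dist_eq {X : Type*} [MetricSpace X] {γ : ℝ → X}
    (h : ∀ a ∈ Set.Icc (0 : ℝ) 1, ∀ b ∈ Set.Icc (0 : ℝ) 1,
      dist (γ a) (γ b) = dist (γ 0) (γ 1) * |a - b|) :
    ContinuousOn γ (Set.Icc 0 1) ∧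
      eVariationOn γ (Set.Icc 0 1) = ENNReal.ofReal (dist (γ 0) (γ 1)) := by
  have hL : LipschitzOnWith (nndist (γ 0) (γ 1)) γ (Set.Icc 0 1) :=
    LipschitzOnWith.of_dist_le_mul fun a ha b hb => by
      rw [coe_nndist, h a ha b hb, Real.dist_eq]
  refine ⟨hL.continuousOn, le_antisymm ?_ ?_⟩
  · have h1 := hL.comp_eVariationOn_le (Set.mapsTo_id (Set.Icc (0 : ℝ) 1))
    have h2 : eVariationOn (id : ℝ → ℝ) (Set.Icc 0 1) ≤ ENNReal.ofReal (1 - 0) := by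
      simp
    calc eVariationOn γ (Set.Icc 0 1)
        ≤ nndist (γ 0) (γ 1) * eVariationOn (id : ℝ → ℝ) (Set.Icc 0 1) := h1
      _ ≤ nndist (γ 0) (γ 1) * ENNReal.ofReal (1 - 0) := by gcongr
      _ = ENNReal.ofReal (dist (γ 0) (γ 1)) := by
        rw [sub_zero, ENNReal.ofReal_one, mul_one, ← edist_nndist, edist_dist]
  · rw [← edist_dist]
    exact eVariationOn.edist_le γ (Set.left_mem_Icc.2 zero_le_one)
      (Set.right_mem_Icc.2 zero_le_one)

/-- A set whose points are joined, within the set, by paths of constant speed is geodesic. -/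
theorem isGeodesicSpace_of_dist_eq {Y : Type*} [MetricSpace Y] {S : Set Y}
    (h : ∀ x ∈ S, ∀ y ∈ S, ∃ c : ℝ → Y, c 0 = x ∧ c 1 = y ∧
      (∀ r ∈ Set.Icc (0 : ℝ) 1, c r ∈ S) ∧
      ∀ a ∈ Set.Icc (0 : ℝ) 1, ∀ b ∈ Set.Icc (0 : ℝ) 1,
        dist (c a) (c b) = dist x y * |a - b|) : IsGeodesicSpace S := by
  rintro ⟨x, hx⟩ ⟨y, hy⟩
  obtain ⟨c, rfl, rfl, hS, hd⟩ := h x hx y hy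
  classical
  let γ : ℝ → S := fun r => if hr : c r ∈ S then ⟨c r, hr⟩ else ⟨c 0, hx⟩
  have hγ : ∀ r ∈ Set.Icc (0 : ℝ) 1, (γ r : Y) = c r := fun r hr => by
    simp only [γ, dif_pos (hS r hr)]
  have h0 : γ 0 = ⟨c 0, hx⟩ := Subtype.ext (hγ 0 (by simp))
  have h1 : γ 1 = ⟨c 1, hy⟩ := Subtype.ext (hγ 1 (by simp))
  have key := eVariationOn_eq_of_dist_eq (γ := γ) fun a ha b hb => by
    rw [Subtype.dist_eq, hγ a ha, hγ b hb, h0, h1, Subtype.dist_eq]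
    exact hd a ha b hb
  rw [h0, h1] at key
  exact ⟨γ, key.1, h0, h1, key.2⟩

theorem isGeodesicSpace_tripodE : IsGeodesicSpace TripodE := by
  refine isGeodesicSpace_of_dist_eq ?_
  rintro x ⟨i, s, hs0, hs1, hx⟩ y ⟨j, t, ht0, ht1, hy⟩
  change x = axisPoint i s at hx
  change y = axisPoint j t at hy
  subst hx hy
  by_cases hij : i = j
  · subst hij
    refine ⟨fun r => axisPoint i ((1 - r) * s + r * t), by simp, by simp, ?_, ?_⟩
    · rintro r ⟨hr0, hr1⟩
      apply axisPoint_mem <;> nlinarith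
    · intro a _ b _
      simp only [dist_axisPoint, if_true]
      rw [← abs_mul, abs_sub_comm]
      congr 1
      ring
  · let pos : ℝ → ℝ := fun r => r * (s + t) - s
    let c : ℝ → PiLp 1 fun _ : Fin 3 => ℝ := fun r =>
      if pos r ≤ 0 then axisPoint i (-pos r) else axisPoint j (pos r)
    have hst : dist (axisPoint i s) (axisPoint j t) = s + t := by
      rw [dist_axisPoint, if_neg hij, abs_of_nonneg hs0, abs_of_nonneg ht0]
    refine ⟨c, ?_, ?_, ?_, ?_⟩
    · simp [c, pos, hs0]
    · by_cases h : t ≤ 0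
      · obtain rfl : t = 0 := le_antisymm h ht0
        simp only [c, pos]
        rw [if_pos (by linarith), ← dist_eq_zero, dist_axisPoint, if_neg hij]
        simp
      · simp [c, pos, h]
    · rintro r ⟨hr0, hr1⟩
      simp only [c]
      split_ifs with h <;> apply axisPoint_mem <;> simp only [pos] at h ⊢ <;> nlinarith
    · rintro a - b -
      have hab : pos a - pos b = (s + t) * (a - b) := by simp only [pos]; ring
      rw [hst, ← abs_of_nonneg (add_nonneg hs0 ht0), ← abs_mul, ← hab]
      simp only [c]
      split_ifs with ha hb hb <;> simp only [dist_axisPoint, if_true, if_neg hij, if_neg (Ne.symm hij)]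
      · rw [abs_sub_comm]; congr 1; ring
      · rw [abs_of_nonneg (by linarith), abs_of_nonneg (by linarith : 0 ≤ pos b),
          abs_of_nonpos (by linarith)]
        ring
      · rw [abs_of_nonneg (by linarith), abs_of_nonneg (by linarith : 0 ≤ -pos b),
          abs_of_nonneg (by linarith)]
        ring

theorem norm_coe_circle {x : ℝ} (hx : |x| ≤ 2 * π) :
    ‖(x : IntrinsicCircle)‖ = min |x| (2 * π - |x|) := by
  have hpi := pi_pos
  have hp : |2 * π| = 2 * π := abs_of_pos (by positivity)
  wlog h0 : 0 ≤ x generalizing x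
  · have := this (x := -x) (by rwa [abs_neg]) (by linarith)
    rwa [AddCircle.coe_neg, norm_neg, abs_neg] at this
  rw [abs_of_nonneg h0] at *
  rcases le_total x π with h | h
  · rw [min_eq_left (by linarith), (AddCircle.norm_coe_eq_abs_iff (2 * π) (by positivity)).2,
      abs_of_nonneg h0]
    rw [hp, abs_of_nonneg h0]; linarith
  · have h2 : (x : IntrinsicCircle) = ((x - 2 * π : ℝ) : IntrinsicCircle) := by
      rw [AddCircle.coe_sub, AddCircle.coe_period, sub_zero]
    have h3 : |x - 2 * π| = 2 * π - x := by rw [abs_of_nonpos (by linarith)]; ring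
    rw [min_eq_right (by linarith), h2,
      (AddCircle.norm_coe_eq_abs_iff (2 * π) (by positivity)).2, h3]
    rw [hp, h3]; linarith

theorem dist_add_pi (x : IntrinsicCircle) : dist x (x + (π : ℝ)) = π := by
  have hpi := pi_pos
  rw [dist_eq_norm, sub_add_cancel_left, norm_neg,
    norm_coe_circle (by rw [abs_of_pos hpi]; linarith), abs_of_pos hpi, min_eq_left (by linarith)]

theorem dist_zero_le_pi_div_two {p : PiLp 1 fun _ : Fin 3 => ℝ} (hp : p ∈ TripodSet) :
    dist 0 p ≤ π / 2 := by
  obtain ⟨i, t, h0, h1, rfl⟩ := hp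
  have h : (0 : PiLp 1 fun _ : Fin 3 => ℝ) = axisPoint i 0 := by
    ext j
    simp [axisPoint]
  change dist 0 (axisPoint i t) ≤ _
  rw [h, dist_axisPoint, if_pos rfl, zero_sub, abs_neg, abs_of_nonneg h0]
  exact h1.trans (tripodLeg_le i)

/-- The antipode of a point corresponding to the centre of the tripod corresponds to a point
at distance at most `π / 2` from the centre. -/
theorem pi_div_two_le_distortion {R : Set (TripodE × IntrinsicCircle)} (hR : IsCorrespondence R) :
    ENNReal.ofReal (π / 2) ≤ distortion R := by
  obtain ⟨x, hx⟩ := hR.1 ⟨0, zero_mem_tripodSet⟩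
  obtain ⟨p, hp⟩ := hR.2 (x + (π : ℝ))
  have h := dist_zero_le_pi_div_two p.2
  refine le_trans (ENNReal.ofReal_le_ofReal ?_)
    (le_iSup₂_of_le (⟨_, hx⟩ : R) (⟨_, hp⟩ : R) le_rfl)
  rw [dist_add_pi, abs_sub_comm]
  exact le_trans (by rw [Subtype.dist_eq]; linarith) (le_abs_self _)

/-- `LegAngle i t θ` holds if the point at distance `t` from the centre on the `i`-th leg of the
tripod is matched with the angle `θ` by the optimal correspondence with the circle. -/
def LegAngle (i : Fin 3) (t θ : ℝ) : Prop :=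
  (i = 0 ∧ 0 ≤ t ∧ t ≤ π / 2 ∧ θ = -π / 2 - t) ∨
  (i = 0 ∧ π / 4 ≤ t ∧ t ≤ π / 2 ∧ θ = π / 2 + t) ∨
  (i = 1 ∧ 0 ≤ t ∧ t ≤ π / 2 ∧ θ = t) ∨
  (i = 1 ∧ π / 4 ≤ t ∧ t ≤ π / 2 ∧ θ = π - t) ∨
  (i = 2 ∧ 0 ≤ t ∧ t ≤ π / 4 ∧ θ = -t) ∨
  (i = 2 ∧ 0 ≤ t ∧ t ≤ π / 4 ∧ θ = -π / 2 + t) ∨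
  (i = 2 ∧ 0 ≤ t ∧ t ≤ π / 4 ∧ θ = -π / 2 - t)

theorem LegAngle.bounds {i : Fin 3} {t θ : ℝ} (h : LegAngle i t θ) :
    0 ≤ t ∧ t ≤ tripodLeg i ∧ -π ≤ θ ∧ θ ≤ π := by
  have hpi := pi_pos
  rcases h with ⟨rfl, h0, h1, rfl⟩ | ⟨rfl, h0, h1, rfl⟩ | ⟨rfl, h0, h1, rfl⟩ | ⟨rfl, h0, h1, rfl⟩ |
    ⟨rfl, h0, h1, rfl⟩ | ⟨rfl, h0, h1, rfl⟩ | ⟨rfl, h0, h1, rfl⟩ <;>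
  simp [tripodLeg] <;> refine ⟨?_, ?_, ?_, ?_⟩ <;> linarith

theorem exists_legAngle_of_le {i : Fin 3} {t : ℝ} (h0 : 0 ≤ t) (h1 : t ≤ tripodLeg i) :
    ∃ θ, LegAngle i t θ := by
  fin_cases i <;> simp [tripodLeg] at h1 <;> simp [LegAngle, h0, h1]

theorem exists_legAngle_of_angle {θ : ℝ} (h0 : -π ≤ θ) (h1 : θ ≤ π) :
    ∃ i t, LegAngle i t θ := by
  rcases le_total θ (-3 * π / 4) with h | h
  · exact ⟨0, -π / 2 - θ, Or.inl ⟨rfl, by linarith, by linarith, by ring⟩⟩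
  rcases le_total θ (-π / 2) with h' | h'
  · exact ⟨2, -π / 2 - θ, by
      iterate 6 apply Or.inr
      exact ⟨rfl, by linarith, by linarith, by ring⟩⟩
  rcases le_total θ (-π / 4) with h | h
  · exact ⟨2, θ + π / 2, by
      iterate 5 apply Or.inr
      exact Or.inl ⟨rfl, by linarith, by linarith, by ring⟩⟩
  rcases le_total θ 0 with h' | h'
  · exact ⟨2, -θ, by
      iterate 4 apply Or.inr
      exact Or.inl ⟨rfl, by linarith, by linarith, by ring⟩⟩
  rcases le_total θ (π / 2) with h | h
  · exact ⟨1, θ, Or.inr (Or.inr (Or.inl ⟨rfl, h', h, rfl⟩))⟩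
  rcases le_total θ (3 * π / 4) with h' | h'
  · exact ⟨1, π - θ, Or.inr (Or.inr (Or.inr (Or.inl ⟨rfl, by linarith, by linarith, by ring⟩)))⟩
  · exact ⟨0, θ - π / 2, Or.inr (Or.inl ⟨rfl, by linarith, by linarith, by ring⟩)⟩

theorem LegAngle.abs_sub_le {i j : Fin 3} {s t α β : ℝ} (hs : LegAngle i s α)
    (ht : LegAngle j t β) :
    |(if i = j then |s - t| else s + t) - min |α - β| (2 * π - |α - β|)| ≤ π / 2 := by
  have hpi := pi_pos
  rcases hs with ⟨rfl, h0, h1, rfl⟩ | ⟨rfl, h0, h1, rfl⟩ | ⟨rfl, h0, h1, rfl⟩ |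
    ⟨rfl, h0, h1, rfl⟩ | ⟨rfl, h0, h1, rfl⟩ | ⟨rfl, h0, h1, rfl⟩ | ⟨rfl, h0, h1, rfl⟩ <;>
  rcases ht with ⟨rfl, h2, h3, rfl⟩ | ⟨rfl, h2, h3, rfl⟩ | ⟨rfl, h2, h3, rfl⟩ |
    ⟨rfl, h2, h3, rfl⟩ | ⟨rfl, h2, h3, rfl⟩ | ⟨rfl, h2, h3, rfl⟩ | ⟨rfl, h2, h3, rfl⟩ <;>
  norm_num <;> grind

/-- The correspondence between the tripod and the circle induced by `LegAngle`. -/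
def legAngleRel : Set (TripodE × IntrinsicCircle) :=
  {q | ∃ i t θ, LegAngle i t θ ∧ (q.1 : PiLp 1 fun _ : Fin 3 => ℝ) = axisPoint i t ∧
    q.2 = (θ : ℝ)}

theorem isCorrespondence_legAngleRel : IsCorrespondence legAngleRel := by
  constructor
  · rintro ⟨p, i, t, h0, h1, rfl⟩
    obtain ⟨θ, h⟩ := exists_legAngle_of_le h0 h1
    exact ⟨(θ : ℝ), i, t, θ, h, rfl, rfl⟩
  · intro y
    obtain ⟨θ, hθ, rfl⟩ : ∃ θ ∈ Set.Ico (-π) (-π + 2 * π), ((θ : ℝ) : IntrinsicCircle) = y := by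
      have h := AddCircle.coe_image_Ico_eq (2 * π) (-π)
      have hy : y ∈ (Set.univ : Set IntrinsicCircle) := Set.mem_univ y
      rw [← h] at hy
      exact hy
    obtain ⟨i, t, h⟩ := exists_legAngle_of_angle hθ.1 (by linarith [hθ.2])
    exact ⟨⟨axisPoint i t, axisPoint_mem h.bounds.1 h.bounds.2.1⟩, i, t, θ, h, rfl, rfl⟩

theorem distortion_legAngleRel_le : distortion legAngleRel ≤ ENNReal.ofReal (π / 2) := by
  refine iSup₂_le ?_
  rintro ⟨⟨p, x⟩, i, s, α, hs, hp, hx⟩ ⟨⟨q, y⟩, j, t, β, ht, hq, hy⟩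
  dsimp only at hp hx hq hy ⊢
  apply ENNReal.ofReal_le_ofReal
  obtain ⟨hs0, -, hα⟩ := hs.bounds
  obtain ⟨ht0, -, hβ⟩ := ht.bounds
  rw [Subtype.dist_eq, hp, hq, hx, hy, dist_axisPoint, abs_of_nonneg hs0, abs_of_nonneg ht0,
    dist_eq_norm, ← AddCircle.coe_sub,
    norm_coe_circle (abs_le.2 ⟨by linarith, by linarith⟩)]
  exact hs.abs_sub_le ht

/-- The tripod `E` with legs of lengths `π/2, π/2, π/4` is a compact, simply connected
geodesic space with `d_GH(E, S¹) = π/4`. -/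
theorem tripod_ghDist_circle_eq_pi_div_four :
    CompactSpace TripodE ∧ SimplyConnectedSpace TripodE ∧ IsGeodesicSpace TripodE ∧
      ghDist TripodE IntrinsicCircle = ENNReal.ofReal (π / 4) := by
  refine ⟨isCompact_iff_compactSpace.1 isCompact_tripodSet, simplyConnectedSpace_tripodE,
    isGeodesicSpace_tripodE, ?_⟩
  have h : (⨅ R : {R : Set (TripodE × IntrinsicCircle) // IsCorrespondence R},
      distortion (R : Set (TripodE × IntrinsicCircle))) = ENNReal.ofReal (π / 2) :=
    le_antisymm (iInf_le_of_le ⟨_, isCorrespondence_legAngleRel⟩ distortion_legAngleRel_le)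
      (le_iInf fun R => pi_div_two_le_distortion R.2)
  rw [ghDist, h, show (2 : ℝ≥0∞) = ENNReal.ofReal 2 by simp,
    ← ENNReal.ofReal_div_of_pos two_pos]
  congr 1
  ring

end
end

section
/- Let (X, d_X) and (Y, d_Y) be length spaces isometrically embedded into a metric space (Z, d_Z), let D > 0 be such that the Hausdorff distance in Z between X and Y is strictly less than D, and let x₀ ∈ X, y₀ ∈ Y with d_Z(x₀, y₀) < D. Assume additionally that every loop in Y of diameter < 4D is nulhomotopic in Y. If α, α' : [0,1] → X are loops based at x₀ that are path-homotopic in X, and β, β' : [0,1] → Y are loops based at y₀ satisfying d_Z(α(t), β(t)) < 2D and d_Z(α'(t), β'(t)) < 2D for all t ∈ [0,1], then β and β' are path-homotopic in Y. (Hence α ↦ β induces a well-defined map Φ : π₁(X, x₀) → π₁(Y, y₀).) -/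
open Real Set Metric
open scoped ENNReal unitInterval

noncomputable section

/-- The path `p`, sampled at its endpoints and any two intermediate points, has length at
most `ℓ`. -/
def PathLengthLE {Y : Type*} [MetricSpace Y] {a b : Y} (p : Path a b) (ℓ : ℝ) : Prop :=
  ∀ s t : unitInterval, s ≤ t → dist a (p s) + dist (p s) (p t) + dist (p t) b ≤ ℓ

namespace PathLengthLE

variable {Y : Type*} [MetricSpace Y] {a b c d : Y}

theorem mono {p : Path a b} {ℓ ℓ' : ℝ} (hp : PathLengthLE p ℓ) (h : ℓ ≤ ℓ') :
    PathLengthLE p ℓ' :=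
  fun s t hst => (hp s t hst).trans h

theorem refl (a : Y) : PathLengthLE (Path.refl a) 0 := fun s t _ => by simp

theorem of_forall_dist_le {p : Path a b} {η : ℝ} (h : ∀ s t, dist (p s) (p t) ≤ η) :
    PathLengthLE p (3 * η) := by
  intro s t _
  have h1 := h 0 s
  have h2 := h s t
  have h3 := h t 1
  rw [p.source] at h1
  rw [p.target] at h3
  linarith

theorem dist_add_dist_le {p : Path a b} {ℓ : ℝ} (hp : PathLengthLE p ℓ) (s : unitInterval) :
    dist a (p s) + dist (p s) b ≤ ℓ := by
  simpa using hp s s le_rfl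

theorem dist_le {p : Path a b} {ℓ : ℝ} (hp : PathLengthLE p ℓ) : dist a b ≤ ℓ :=
  (dist_triangle a (p 0) b).trans (hp.dist_add_dist_le 0)

theorem dist_le_half {p : Path a b} {ℓ m : ℝ} (hp : PathLengthLE p ℓ) (hm : dist a b ≤ m)
    (s t : unitInterval) : dist (p s) (p t) ≤ (ℓ + m) / 2 := by
  wlog hst : s ≤ t generalizing s t
  · rw [dist_comm]
    exact this t s (le_of_not_ge hst)
  have h1 := hp s t hst
  have h2 := dist_triangle4 (p s) a b (p t)
  rw [dist_comm (p s) a, dist_comm b] at h2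
  linarith

/-- The boundary of a quadrilateral of perimeter `L` has diameter at most `L / 2`. -/
theorem dist_le_of_quadrilateral {p : Path a b} {q : Path b c} {v : Path a d} {r : Path d c}
    {ℓp ℓq ℓv ℓr : ℝ} (hp : PathLengthLE p ℓp) (hq : PathLengthLE q ℓq)
    (hv : PathLengthLE v ℓv) (hr : PathLengthLE r ℓr) {u w : Y}
    (hu : u ∈ (range p ∪ range q) ∪ (range v ∪ range r))
    (hw : w ∈ (range p ∪ range q) ∪ (range v ∪ range r)) :
    dist u w ≤ (ℓp + ℓq + ℓv + ℓr) / 2 := by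
  have ep := hp.dist_le
  have eq := hq.dist_le
  have ev := hv.dist_le
  have er := hr.dist_le
  rcases hu with (⟨s, rfl⟩ | ⟨s, rfl⟩) | (⟨s, rfl⟩ | ⟨s, rfl⟩) <;>
  rcases hw with (⟨t, rfl⟩ | ⟨t, rfl⟩) | (⟨t, rfl⟩ | ⟨t, rfl⟩)
  · have h := dist_triangle4 a d c b
    rw [dist_comm c b] at h
    have := hp.dist_le_half (m := ℓv + ℓr + ℓq) (by linarith) s t
    linarith
  · have h1 := hp.dist_add_dist_le s
    have h2 := hq.dist_add_dist_le t
    have h3 := dist_triangle (p s) b (q t)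
    have h4 := dist_triangle4 (p s) a d (q t)
    have h5 := dist_triangle d c (q t)
    simp only [dist_comm (p s) a, dist_comm c (q t)] at *
    linarith
  · have h1 := hp.dist_add_dist_le s
    have h2 := hv.dist_add_dist_le t
    have h3 := dist_triangle (p s) a (v t)
    have h4 := dist_triangle4 (p s) b c (v t)
    have h5 := dist_triangle c d (v t)
    simp only [dist_comm (p s) a, dist_comm d (v t), dist_comm c d] at *
    linarith
  · have h1 := hp.dist_add_dist_le s
    have h2 := hr.dist_add_dist_le t
    have h3 := dist_triangle4 (p s) b c (r t)
    have h4 := dist_triangle4 (p s) a d (r t)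
    simp only [dist_comm (p s) a, dist_comm c (r t)] at *
    linarith
  · have h1 := hp.dist_add_dist_le t
    have h2 := hq.dist_add_dist_le s
    have h3 := dist_triangle (p t) b (q s)
    have h4 := dist_triangle4 (p t) a d (q s)
    have h5 := dist_triangle d c (q s)
    simp only [dist_comm (p t) a, dist_comm c (q s), dist_comm (q s) (p t)] at *
    linarith
  · have h := dist_triangle4 b a d c
    rw [dist_comm b a] at h
    have := hq.dist_le_half (m := ℓp + ℓv + ℓr) (by linarith) s t
    linarith
  · have h1 := hq.dist_add_dist_le s
    have h2 := hv.dist_add_dist_le t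
    have h3 := dist_triangle4 (q s) b a (v t)
    have h4 := dist_triangle4 (q s) c d (v t)
    simp only [dist_comm (q s) b, dist_comm b a, dist_comm c d, dist_comm d (v t)] at *
    linarith
  · have h1 := hq.dist_add_dist_le s
    have h2 := hr.dist_add_dist_le t
    have h3 := dist_triangle (q s) c (r t)
    have h4 := dist_triangle4 (q s) b a (r t)
    have h5 := dist_triangle a d (r t)
    simp only [dist_comm (q s) b, dist_comm b a, dist_comm c (r t)] at *
    linarith
  · have h1 := hp.dist_add_dist_le t
    have h2 := hv.dist_add_dist_le s
    have h3 := dist_triangle (p t) a (v s)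
    have h4 := dist_triangle4 (p t) b c (v s)
    have h5 := dist_triangle c d (v s)
    simp only [dist_comm (p t) a, dist_comm d (v s), dist_comm c d, dist_comm (v s) (p t)] at *
    linarith
  · have h1 := hq.dist_add_dist_le t
    have h2 := hv.dist_add_dist_le s
    have h3 := dist_triangle4 (q t) b a (v s)
    have h4 := dist_triangle4 (q t) c d (v s)
    simp only [dist_comm (q t) b, dist_comm b a, dist_comm c d, dist_comm d (v s),
      dist_comm (v s) (q t)] at *
    linarith
  · have h := dist_triangle4 a b c d
    rw [dist_comm c d] at h
    have := hv.dist_le_half (m := ℓp + ℓq + ℓr) (by linarith) s t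
    linarith
  · have h1 := hv.dist_add_dist_le s
    have h2 := hr.dist_add_dist_le t
    have h3 := dist_triangle (v s) d (r t)
    have h4 := dist_triangle4 (v s) a b (r t)
    have h5 := dist_triangle b c (r t)
    simp only [dist_comm (v s) a, dist_comm c (r t)] at *
    linarith
  · have h1 := hp.dist_add_dist_le t
    have h2 := hr.dist_add_dist_le s
    have h3 := dist_triangle4 (p t) b c (r s)
    have h4 := dist_triangle4 (p t) a d (r s)
    simp only [dist_comm (p t) a, dist_comm c (r s), dist_comm (r s) (p t)] at *
    linarith
  · have h1 := hq.dist_add_dist_le t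
    have h2 := hr.dist_add_dist_le s
    have h3 := dist_triangle (q t) c (r s)
    have h4 := dist_triangle4 (q t) b a (r s)
    have h5 := dist_triangle a d (r s)
    simp only [dist_comm (q t) b, dist_comm b a, dist_comm c (r s), dist_comm (r s) (q t)] at *
    linarith
  · have h1 := hv.dist_add_dist_le t
    have h2 := hr.dist_add_dist_le s
    have h3 := dist_triangle (v t) d (r s)
    have h4 := dist_triangle4 (v t) a b (r s)
    have h5 := dist_triangle b c (r s)
    simp only [dist_comm (v t) a, dist_comm c (r s), dist_comm (r s) (v t)] at *
    linarith
  · have h := dist_triangle4 d a b c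
    rw [dist_comm d a] at h
    have := hr.dist_le_half (m := ℓv + ℓp + ℓq) (by linarith) s t
    linarith

end PathLengthLE

/-- In a length space, nearly shortest paths can be chosen between all pairs of points,
constant on the diagonal. -/
theorem IsLengthSpace.exists_paths {Y : Type*} [MetricSpace Y] (hY : IsLengthSpace Y) {ε : ℝ}
    (hε : 0 < ε) : ∃ τ : ∀ a b : Y, Path a b, (∀ a, τ a a = Path.refl a) ∧
      ∀ a b, PathLengthLE (τ a b) (dist a b + ε) := by
  have key : ∀ a b : Y, ∃ p : Path a b, PathLengthLE p (dist a b + ε) ∧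
      (∀ h : a = b, p = (Path.refl a).cast rfl h.symm) := by
    intro a b
    by_cases hab : a = b
    · subst hab
      exact ⟨Path.refl a, (PathLengthLE.refl a).mono (by simp [hε.le]), fun _ => rfl⟩
    have hlt : ENNReal.ofReal (dist a b) < ENNReal.ofReal (dist a b + ε) :=
      (ENNReal.ofReal_lt_ofReal_iff (by positivity)).2 (by linarith)
    rw [hY a b] at hlt
    simp only [iInf_lt_iff] at hlt
    obtain ⟨γ, ⟨hc, h0, h1⟩, hγ⟩ := hlt
    refine ⟨⟨⟨fun t => γ t, hc.comp_continuous continuous_subtype_val fun t => t.2⟩,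
      by simpa using h0, by simpa using h1⟩, ?_, fun h => absurd h hab⟩
    intro s t hst
    have hst' : (s : ℝ) ≤ t := hst
    have e1 := eVariationOn.edist_le γ (s := Icc (0 : ℝ) 1 ∩ Icc 0 s)
      (x := 0) (y := s) ⟨by simp, by simp [s.2.1]⟩ ⟨s.2, by simp [s.2.1]⟩
    have e2 := eVariationOn.edist_le γ (s := Icc (0 : ℝ) 1 ∩ Icc s t)
      (x := s) (y := t) ⟨s.2, by simp [hst']⟩ ⟨t.2, by simp [hst']⟩
    have e3 := eVariationOn.edist_le γ (s := Icc (0 : ℝ) 1 ∩ Icc t 1)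
      (x := t) (y := 1) ⟨t.2, by simp [t.2.2]⟩ ⟨by simp, by simp [t.2.2]⟩
    have hsum := add_le_add (add_le_add e1 e2) e3
    rw [eVariationOn.Icc_add_Icc γ s.2.1 hst' s.2,
      eVariationOn.Icc_add_Icc γ t.2.1 t.2.2 t.2, inter_self, h0, h1] at hsum
    have hlt := hsum.trans_lt hγ
    rw [edist_dist, edist_dist, edist_dist, ← ENNReal.ofReal_add (by positivity) (by positivity),
      ← ENNReal.ofReal_add (by positivity) (by positivity),
      ENNReal.ofReal_lt_ofReal_iff (by positivity)] at hlt
    exact hlt.le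
  choose τ hτ hτ' using key
  exact ⟨τ, fun a => hτ' a a rfl, hτ⟩

/-- A based loop that is freely nulhomotopic is nulhomotopic relative to its basepoint. -/
theorem IsNullLoop.homotopic_refl {Y : Type*} [TopologicalSpace Y] {a : Y} {γ : Path a a}
    (h : IsNullLoop γ.toContinuousMap) : γ.Homotopic (Path.refl a) := by
  obtain ⟨y, H, h0, h1, hs⟩ := h
  have h0' : ∀ t, H (0, t) = γ t := h0
  have h1' : ∀ t, H (1, t) = y := h1
  let B : Path ((0, 0) : unitInterval × unitInterval) (0, 1) :=
    ⟨⟨fun t => (0, t), by fun_prop⟩, rfl, rfl⟩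
  let L : Path ((0, 0) : unitInterval × unitInterval) (1, 0) :=
    ⟨⟨fun t => (t, 0), by fun_prop⟩, rfl, rfl⟩
  let T : Path ((1, 0) : unitInterval × unitInterval) (1, 1) :=
    ⟨⟨fun t => (1, t), by fun_prop⟩, rfl, rfl⟩
  let R : Path ((0, 1) : unitInterval × unitInterval) (1, 1) :=
    ⟨⟨fun t => (t, 1), by fun_prop⟩, rfl, rfl⟩
  have : ContractibleSpace unitInterval :=
    (convex_Icc (0 : ℝ) 1).contractibleSpace ⟨0, by simp⟩
  have hsq := (SimplyConnectedSpace.paths_homotopic B (L.trans (T.trans R.symm))).map H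
  have ha : H (0, 0) = a := by rw [h0', γ.source]
  have ha' : H (0, 1) = a := by rw [h0', γ.target]
  let q : Path a y := (L.map H.continuous).cast ha.symm (h1' 0).symm
  have e1 : (B.map H.continuous).cast ha.symm ha'.symm = γ := by
    ext t
    exact h0' t
  have e2 : ((L.trans (T.trans R.symm)).map H.continuous).cast ha.symm ha'.symm =
      q.trans ((Path.refl y).trans q.symm) := by
    have eT : (T.map H.continuous).cast (h1' 0).symm (h1' 1).symm = Path.refl y := by
      ext t
      exact h1' t
    have eR : (R.map H.continuous).cast ha'.symm (h1' 1).symm = q := by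
      ext t
      exact (hs t).symm
    rw [← eT]
    nth_rewrite 2 [← eR]
    ext t
    simp only [Path.map_trans, Path.cast_coe, Path.trans_apply]
    rfl
  have hc := hsq.pathCast ha.symm ha'.symm
  have : γ.Homotopic (q.trans ((Path.refl y).trans q.symm)) := by
    rw [← e1, ← e2]
    exact hc
  refine this.trans ?_
  rw [← Path.Homotopic.Quotient.eq]
  simp

/-- Two sides of a quadrilateral of perimeter less than `8 * D` are homotopic if loops of
diameter less than `4 * D` are nulhomotopic. -/
theorem trans_homotopic_of_quadrilateral {Y : Type*} [MetricSpace Y] {D : ℝ}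
    (hloopY : ∀ γ : C(unitInterval, Y), IsLoop γ → Metric.diam (Set.range γ) < 4 * D →
      IsNullLoop γ) {a b c d : Y} {p : Path a b} {q : Path b c} {v : Path a d} {r : Path d c}
    {ℓp ℓq ℓv ℓr : ℝ} (hp : PathLengthLE p ℓp) (hq : PathLengthLE q ℓq)
    (hv : PathLengthLE v ℓv) (hr : PathLengthLE r ℓr) (hD : ℓp + ℓq + ℓv + ℓr < 8 * D) :
    (p.trans q).Homotopic (v.trans r) := by
  have hnull : IsNullLoop ((p.trans q).trans (v.trans r).symm).toContinuousMap := by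
    refine hloopY _ (by simp [IsLoop]) ?_
    have hrange : range ((p.trans q).trans (v.trans r).symm).toContinuousMap =
        (range p ∪ range q) ∪ (range v ∪ range r) := by
      change range ((p.trans q).trans (v.trans r).symm) = _
      rw [Path.trans_range, Path.symm_range, Path.trans_range, Path.trans_range]
    rw [hrange]
    have hdist := fun {u w : Y} => hp.dist_le_of_quadrilateral hq hv hr (u := u) (w := w)
    refine lt_of_le_of_lt (Metric.diam_le_of_forall_dist_le
      (C := (ℓp + ℓq + ℓv + ℓr) / 2) ?_ fun u hu w hw => hdist hu hw) (by linarith)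
    have := hp.dist_le
    have := hq.dist_le
    have := hv.dist_le
    have := hr.dist_le
    have := @dist_nonneg _ _ a b
    have := @dist_nonneg _ _ b c
    have := @dist_nonneg _ _ a d
    have := @dist_nonneg _ _ d c
    linarith
  have h := hnull.homotopic_refl
  rw [← Path.Homotopic.Quotient.eq] at h ⊢
  have h' := congrArg (fun x => x.trans (Path.Homotopic.Quotient.mk (v.trans r))) h
  rwa [Path.Homotopic.Quotient.mk_trans, Path.Homotopic.Quotient.mk_symm,
    Path.Homotopic.Quotient.trans_assoc, Path.Homotopic.Quotient.symm_trans,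
    Path.Homotopic.Quotient.trans_refl, Path.Homotopic.Quotient.mk_refl,
    Path.Homotopic.Quotient.refl_trans] at h'

/-- The homotopy class of the concatenation of the first `n` paths of a sequence. -/
def concatClass {Y : Type*} [TopologicalSpace Y] {y : ℕ → Y}
    (h : ∀ i, Path (y i) (y (i + 1))) : ∀ n, Path.Homotopic.Quotient (y 0) (y n)
  | 0 => Path.Homotopic.Quotient.refl _
  | n + 1 => (concatClass h n).trans (Path.Homotopic.Quotient.mk (h n))

theorem concatClass_subpath {Y : Type*} [TopologicalSpace Y] {a b : Y} (γ : Path a b)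
    (t : ℕ → unitInterval) (n : ℕ) :
    concatClass (y := fun i => γ (t i)) (fun i => γ.subpath (t i) (t (i + 1))) n =
      Path.Homotopic.Quotient.mk (γ.subpath (t 0) (t n)) := by
  induction n with
  | zero => simp [concatClass]
  | succ n ih =>
    rw [concatClass, ih, ← Path.Homotopic.Quotient.mk_trans, Path.Homotopic.Quotient.eq]
    exact ⟨Path.Homotopy.subpathTransSubpath γ _ _ _⟩

theorem concatClass_trans_comm {Y : Type*} [TopologicalSpace Y] {y y' : ℕ → Y}
    (h : ∀ i, Path (y i) (y (i + 1))) (h' : ∀ i, Path (y' i) (y' (i + 1)))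
    (v : ∀ i, Path (y i) (y' i))
    (hv : ∀ i, ((h i).trans (v (i + 1))).Homotopic ((v i).trans (h' i))) (n : ℕ) :
    (concatClass h n).trans (Path.Homotopic.Quotient.mk (v n)) =
      (Path.Homotopic.Quotient.mk (v 0)).trans (concatClass h' n) := by
  induction n with
  | zero => simp [concatClass]
  | succ n ih =>
    have e := Path.Homotopic.Quotient.eq.2 (hv n)
    rw [Path.Homotopic.Quotient.mk_trans, Path.Homotopic.Quotient.mk_trans] at e
    rw [concatClass, concatClass, Path.Homotopic.Quotient.trans_assoc, e,
      ← Path.Homotopic.Quotient.trans_assoc, ih, Path.Homotopic.Quotient.trans_assoc]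

/-- Neighbouring chains of paths with common endpoints are homotopic if the quadrilaterals
between them have perimeter less than `8 * D`. -/
theorem concatClass_cast_eq {Y : Type*} [MetricSpace Y] {D : ℝ}
    (hloopY : ∀ γ : C(unitInterval, Y), IsLoop γ → Metric.diam (Set.range γ) < 4 * D →
      IsNullLoop γ) (τ : ∀ a b : Y, Path a b) (hτ : ∀ a, τ a a = Path.refl a)
    {y y' : ℕ → Y} (h : ∀ i, Path (y i) (y (i + 1))) (h' : ∀ i, Path (y' i) (y' (i + 1)))
    {ℓ ℓ' m : ℝ} (hℓ : ∀ i, PathLengthLE (h i) ℓ) (hℓ' : ∀ i, PathLengthLE (h' i) ℓ')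
    (hm : ∀ i, PathLengthLE (τ (y i) (y' i)) m) (hD : ℓ + ℓ' + 2 * m < 8 * D)
    {a b : Y} {n : ℕ} (h0 : a = y 0) (h0' : a = y' 0) (hn : b = y n) (hn' : b = y' n) :
    (concatClass h n).cast h0 hn = (concatClass h' n).cast h0' hn' := by
  have key := concatClass_trans_comm h h' (fun i => τ (y i) (y' i)) (fun i =>
    trans_homotopic_of_quadrilateral hloopY (hℓ i) (hm (i + 1)) (hm i) (hℓ' i)
      (by linarith)) n
  revert key
  generalize concatClass h n = P
  generalize concatClass h' n = P'
  generalize y 0 = u at *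
  generalize y' 0 = u' at *
  generalize y n = w at *
  generalize y' n = w' at *
  subst h0 h0' hn hn'
  intro key
  simpa [hτ] using key

/-- The `i`-th point of the subdivision of the unit interval into `n` equal parts, constant
for `i ≥ n`. -/
def gridPoint (n i : ℕ) : unitInterval := projIcc 0 1 zero_le_one ((i : ℝ) / n)

theorem gridPoint_zero (n : ℕ) : gridPoint n 0 = 0 := by
  simp [gridPoint]

theorem gridPoint_self {n : ℕ} (hn : 0 < n) : gridPoint n n = 1 := by
  have : (n : ℝ) ≠ 0 := by positivity
  simp [gridPoint, div_self this]

theorem dist_gridPoint_succ_le (n i : ℕ) :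
    dist (gridPoint n i) (gridPoint n (i + 1)) ≤ 1 / n := by
  have h := LipschitzWith.projIcc (zero_le_one (α := ℝ)) |>.dist_le_mul
    ((i : ℝ) / n) (((i + 1 : ℕ) : ℝ) / n)
  refine h.trans (le_of_eq ?_)
  rw [Real.dist_eq, ← sub_div, abs_div]
  simp

theorem dist_subpath_le {Y : Type*} [MetricSpace Y] {a b : Y} (γ : Path a b) {δ η : ℝ}
    (hγ : ∀ s t, dist s t < δ → dist (γ s) (γ t) ≤ η) {t₀ t₁ : unitInterval}
    (ht : dist t₀ t₁ < δ) (s t : unitInterval) :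
    dist (γ.subpath t₀ t₁ s) (γ.subpath t₀ t₁ t) ≤ η := by
  have hmem : ∀ s, ∃ r ∈ uIcc t₀ t₁, γ.subpath t₀ t₁ s = γ r := fun s => by
    have : γ.subpath t₀ t₁ s ∈ range (γ.subpath t₀ t₁) := mem_range_self s
    rw [Path.range_subpath] at this
    obtain ⟨r, hr, hrs⟩ := this
    exact ⟨r, hr, hrs.symm⟩
  obtain ⟨r, hr, hrs⟩ := hmem s
  obtain ⟨r', hr', hrs'⟩ := hmem t
  rw [hrs, hrs']
  refine hγ _ _ (lt_of_le_of_lt ?_ ht)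
  exact Real.dist_le_of_mem_uIcc (x := (r : ℝ)) (y := r')
    (x' := t₀) (y' := t₁) (by simpa [mem_uIcc] using hr) (by simpa [mem_uIcc] using hr')

theorem exists_forall_dist_le_of_continuous {A B : Type*} [MetricSpace A] [CompactSpace A]
    [MetricSpace B] {f : A → B} (hf : Continuous f) {η : ℝ} (hη : 0 < η) :
    ∃ δ > 0, ∀ s t, dist s t < δ → dist (f s) (f t) ≤ η := by
  obtain ⟨δ, hδ, h⟩ := Metric.uniformContinuous_iff.1
    (CompactSpace.uniformContinuous_of_continuous hf) η hη
  exact ⟨δ, hδ, fun s t hst => (h hst).le⟩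

/-- A loop is homotopic to the chain of short paths through accompanying points of nearby
points. -/
theorem mk_eq_concatClass {X Y Z : Type*} [MetricSpace X] [MetricSpace Y] [MetricSpace Z]
    {fX : X → Z} {fY : Y → Z} (hfY : Isometry fY) {D : ℝ}
    (hloopY : ∀ γ : C(unitInterval, Y), IsLoop γ → Metric.diam (Set.range γ) < 4 * D →
      IsNullLoop γ) {τ : ∀ a b : Y, Path a b} (hτ : ∀ a, τ a a = Path.refl a) {ε : ℝ}
    (hτε : ∀ a b, PathLengthLE (τ a b) (dist a b + ε))
    {c : X → Y} {R R' ℓ δ : ℝ} (hc : ∀ x, dist (fX x) (fY (c x)) ≤ R)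
    {x₀ : X} {y₀ : Y} {α : Path x₀ x₀} {β : Path y₀ y₀}
    (hβ : ∀ t, dist (fX (α t)) (fY (β t)) ≤ R')
    (hδ : ∀ s t, dist s t < δ → dist (β s) (β t) ≤ ε) {n : ℕ} (hn : 0 < n)
    (hnδ : 1 / (n : ℝ) < δ)
    (hℓ : ∀ i, PathLengthLE (τ (c (α (gridPoint n i))) (c (α (gridPoint n (i + 1))))) ℓ)
    (hD : 3 * ε + ℓ + 2 * (R' + R + ε) < 8 * D)
    (h0 : y₀ = c (α (gridPoint n 0))) (h1 : y₀ = c (α (gridPoint n n))) :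
    Path.Homotopic.Quotient.mk β =
      (concatClass (y := fun i => c (α (gridPoint n i))) (fun _ => τ _ _) n).cast h0 h1 := by
  have hβ0 : y₀ = β (gridPoint n 0) := by rw [gridPoint_zero, β.source]
  have hβ1 : y₀ = β (gridPoint n n) := by rw [gridPoint_self hn, β.target]
  rw [← concatClass_cast_eq hloopY τ hτ (y := fun i => β (gridPoint n i))
    (y' := fun i => c (α (gridPoint n i)))
    (fun i => β.subpath (gridPoint n i) (gridPoint n (i + 1))) (fun _ => τ _ _)
    (fun i => PathLengthLE.of_forall_dist_le (dist_subpath_le β hδ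
      ((dist_gridPoint_succ_le n i).trans_lt hnδ))) hℓ (m := R' + R + ε) ?_ hD hβ0 h0 hβ1 h1]
  · rw [concatClass_subpath, ← Path.Homotopic.Quotient.mk_cast]
    congr 1
    generalize hs : gridPoint n 0 = s at *
    generalize ht : gridPoint n n = t at *
    rw [gridPoint_zero] at hs
    rw [gridPoint_self hn] at ht
    subst hs ht
    ext t
    simp
  · intro i
    refine (hτε _ _).mono (add_le_add_left ?_ _)
    rw [← hfY.dist_eq]
    refine (dist_triangle_left _ _ (fX (α (gridPoint n i)))).trans ?_
    exact add_le_add (hβ _) (hc _)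

theorem exists_lt_forall_dist_le {Z : Type*} [MetricSpace Z] {f g : unitInterval → Z}
    (hf : Continuous f) (hg : Continuous g) {r : ℝ} (h : ∀ t, dist (f t) (g t) < r) :
    ∃ r' < r, ∀ t, dist (f t) (g t) ≤ r' := by
  obtain ⟨t₀, -, ht₀⟩ := isCompact_univ.exists_isMaxOn (s := (univ : Set unitInterval))
    univ_nonempty (hf.dist hg).continuousOn
  exact ⟨_, h t₀, fun t => ht₀ (mem_univ t)⟩

/-- Accompanying points can be chosen uniformly closer than a bound on the Hausdorff
distance, with a prescribed value at one point. -/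
theorem exists_accompanying_map {X Y Z : Type*} [MetricSpace X] [MetricSpace Y]
    [MetricSpace Z] {fX : X → Z} {fY : Y → Z} {D : ℝ} (hD : 0 < D)
    (hH : Metric.hausdorffEDist (Set.range fX) (Set.range fY) < ENNReal.ofReal D)
    {x₀ : X} {y₀ : Y} (h₀ : dist (fX x₀) (fY y₀) < D) :
    ∃ (c : X → Y) (R : ℝ), R < D ∧ c x₀ = y₀ ∧ ∀ x, dist (fX x) (fY (c x)) ≤ R := by
  classical
  obtain ⟨R, hHR, hRD⟩ := exists_between hH
  have hRtop : R ≠ ⊤ := (hRD.trans ENNReal.ofReal_lt_top).ne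
  have hex : ∀ x, ∃ y, dist (fX x) (fY y) ≤ R.toReal := fun x => by
    obtain ⟨_, ⟨y, rfl⟩, hy⟩ :=
      Metric.exists_edist_lt_of_hausdorffEDist_lt (mem_range_self x) hHR
    refine ⟨y, ?_⟩
    rw [dist_edist]
    exact ENNReal.toReal_mono hRtop hy.le
  choose c hc using hex
  refine ⟨Function.update c x₀ y₀, max R.toReal (dist (fX x₀) (fY y₀)),
    max_lt ?_ h₀, by simp, fun x => ?_⟩
  · rw [← ENNReal.toReal_ofReal hD.le]
    exact (ENNReal.toReal_lt_toReal hRtop ENNReal.ofReal_ne_top).2 hRD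
  · by_cases hx : x = x₀
    · subst hx
      simp
    · rw [Function.update_of_ne hx]
      exact (hc x).trans (le_max_left _ _)

/-- **Theorem 2.2, second part.** In the setting of the first part, if moreover every
loop of diameter `< 4D` in `Y` is nulhomotopic, then loops `β, β'` in `Y` accompanying
path-homotopic loops `α, α'` in `X` (in the sense that `d_Z(α(t), β(t)) < 2D` and
`d_Z(α'(t), β'(t)) < 2D` for all `t`) are path-homotopic; hence `α ↦ β` induces a
well-defined map `π₁(X, x₀) → π₁(Y, y₀)`. -/
theorem close_loops_homotopic {X Y Z : Type*} [MetricSpace X] [MetricSpace Y]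
    [MetricSpace Z]
    (hX : IsLengthSpace X) (hY : IsLengthSpace Y)
    (fX : X → Z) (fY : Y → Z) (hfX : Isometry fX) (hfY : Isometry fY)
    (D : ℝ) (hD : 0 < D)
    (hH : EMetric.hausdorffEdist (Set.range fX) (Set.range fY) < ENNReal.ofReal D)
    (x₀ : X) (y₀ : Y) (h₀ : dist (fX x₀) (fY y₀) < D)
    (hloopY : ∀ γ : C(unitInterval, Y), IsLoop γ → Metric.diam (Set.range γ) < 4 * D →
      IsNullLoop γ)
    (α α' : Path x₀ x₀) (hαα' : α.Homotopic α')
    (β β' : Path y₀ y₀)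
    (hβ : ∀ t : unitInterval, dist (fX (α t)) (fY (β t)) < 2 * D)
    (hβ' : ∀ t : unitInterval, dist (fX (α' t)) (fY (β' t)) < 2 * D) :
    β.Homotopic β' := by
  obtain ⟨c, R, hRD, hc₀, hc⟩ := exists_accompanying_map hD hH h₀
  obtain ⟨R₁, hR₁, hβR⟩ := exists_lt_forall_dist_le
    (hfX.continuous.comp α.continuous) (hfY.continuous.comp β.continuous) hβ
  obtain ⟨R₂, hR₂, hβR'⟩ := exists_lt_forall_dist_le
    (hfX.continuous.comp α'.continuous) (hfY.continuous.comp β'.continuous) hβ'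
  obtain ⟨ε, hε, hεR, hεR₁, hεR₂⟩ : ∃ ε > 0, 4 * ε ≤ D - R ∧ 4 * ε ≤ 2 * D - R₁ ∧
      4 * ε ≤ 2 * D - R₂ :=
    ⟨min (D - R) (min (2 * D - R₁) (2 * D - R₂)) / 4,
      div_pos (lt_min (by linarith) (lt_min (by linarith) (by linarith))) (by norm_num),
      by linarith [min_le_left (D - R) (min (2 * D - R₁) (2 * D - R₂))],
      by linarith [min_le_right (D - R) (min (2 * D - R₁) (2 * D - R₂)),
        min_le_left (2 * D - R₁) (2 * D - R₂)],
      by linarith [min_le_right (D - R) (min (2 * D - R₁) (2 * D - R₂)),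
        min_le_right (2 * D - R₁) (2 * D - R₂)]⟩
  obtain ⟨τ, hτ, hτε⟩ := hY.exists_paths hε
  obtain ⟨F⟩ := hαα'
  obtain ⟨δ₁, hδ₁, hβδ⟩ := exists_forall_dist_le_of_continuous β.continuous hε
  obtain ⟨δ₂, hδ₂, hβδ'⟩ := exists_forall_dist_le_of_continuous β'.continuous hε
  obtain ⟨δ₃, hδ₃, hFδ⟩ := exists_forall_dist_le_of_continuous F.continuous hε
  obtain ⟨k, hk⟩ := exists_nat_one_div_lt (lt_min hδ₁ (lt_min hδ₂ hδ₃))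
  obtain ⟨n, hn, hnδ⟩ : ∃ n : ℕ, 0 < n ∧ 1 / (n : ℝ) < min δ₁ (min δ₂ δ₃) :=
    ⟨k + 1, k.succ_pos, by exact_mod_cast hk⟩
  simp only [lt_min_iff] at hnδ
  obtain ⟨hn₁, hn₂, hn₃⟩ := hnδ
  have hcdist : ∀ x x', dist x x' ≤ ε →
      PathLengthLE (τ (c x) (c x')) (2 * R + 2 * ε) := fun x x' hx => by
    refine (hτε _ _).mono ?_
    rw [← hfY.dist_eq]
    have h1 := dist_triangle4 (fY (c x)) (fX x) (fX x') (fY (c x'))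
    rw [hfX.dist_eq, dist_comm (fY (c x)) (fX x)] at h1
    linarith [hc x, hc x']
  have hrow : ∀ j i, PathLengthLE (τ (c (F.eval (gridPoint n j) (gridPoint n i)))
      (c (F.eval (gridPoint n j) (gridPoint n (i + 1))))) (2 * R + 2 * ε) := fun j i => by
    refine hcdist _ _ (hFδ (_, _) (_, _) ?_)
    rw [dist_prod_same_left]
    exact (dist_gridPoint_succ_le n i).trans_lt hn₃
  have hcol : ∀ j i, PathLengthLE (τ (c (F.eval (gridPoint n j) (gridPoint n i)))
      (c (F.eval (gridPoint n (j + 1)) (gridPoint n i)))) (2 * R + 2 * ε) := fun j i => by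
    refine hcdist _ _ (hFδ (_, _) (_, _) ?_)
    rw [dist_prod_same_right]
    exact (dist_gridPoint_succ_le n j).trans_lt hn₃
  have h0 : ∀ γ : Path x₀ x₀, y₀ = c (γ (gridPoint n 0)) := fun γ => by
    rw [gridPoint_zero, γ.source, hc₀]
  have h1 : ∀ γ : Path x₀ x₀, y₀ = c (γ (gridPoint n n)) := fun γ => by
    rw [gridPoint_self hn, γ.target, hc₀]
  let P : Path x₀ x₀ → Path.Homotopic.Quotient y₀ y₀ := fun γ =>
    (concatClass (y := fun i => c (γ (gridPoint n i))) (fun _ => τ _ _) n).cast (h0 γ) (h1 γ)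
  have hstep : ∀ j, P (F.eval (gridPoint n 0)) = P (F.eval (gridPoint n j)) := fun j => by
    induction j with
    | zero => rfl
    | succ j ih =>
      rw [ih]
      exact concatClass_cast_eq hloopY τ hτ _ _ (hrow j) (hrow (j + 1)) (hcol j)
        (by linarith) _ _ _ _
  have hPP : P α = P α' := by
    have h := hstep n
    rwa [gridPoint_zero, gridPoint_self hn, F.eval_zero, F.eval_one] at h
  have hrow₀ := hrow 0
  have hrow₁ := hrow n
  rw [gridPoint_zero, F.eval_zero] at hrow₀
  rw [gridPoint_self hn, F.eval_one] at hrow₁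
  rw [← Path.Homotopic.Quotient.eq]
  have e := mk_eq_concatClass hfY hloopY hτ hτε hc hβR hβδ hn hn₁ hrow₀
    (by linarith) (h0 α) (h1 α)
  have e' := mk_eq_concatClass hfY hloopY hτ hτε hc hβR' hβδ' hn hn₂ hrow₁
    (by linarith) (h0 α') (h1 α')
  exact e.trans (hPP.trans e'.symm)


end
end
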